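/- In a minimal counterexample (G, S, R, v, P_k(v), Q, k) to the Extension Theorem, no vertex in V(G) − S − R is a cut vertex of G. -/

import Mathlib

/-!
Multigraphs are modelled by a vertex type `V`, an edge type `E`, and an
incidence map `ends : E → Sym2 V` giving the (unordered) pair of endpoints
of each edge.  Subgraphs are identified with their edge sets (`Set E`).
-/

namespace SteinerPacking

variable {V E : Type}

/-- The set of edges incident to a vertex `u` (denoted `E(u)` in the paper). -/
def incEdges (ends : E → Sym2 V) (u : V) : Set E := {e | u ∈ ends e}

/-- The degree `d(u) = |E(u)|` of a vertex. -/
noncomputable def deg (ends : E → Sym2 V) (u : V) : ℕ := (incEdges ends u).ncard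

/-- One step along an edge of the edge set `F`. -/
def Step (ends : E → Sym2 V) (F : Set E) (a b : V) : Prop := ∃ e ∈ F, ends e = s(a, b)

/-- `a` and `b` are joined by a walk using only edges in `F`. -/
def Reaches (ends : E → Sym2 V) (F : Set E) (a b : V) : Prop :=
  Relation.ReflTransGen (Step ends F) a b

/-- The vertex set `S` is connected in the subgraph with edge set `F`. -/
def ConnectsSet (ends : E → Sym2 V) (F : Set E) (S : Set V) : Prop :=
  ∀ a ∈ S, ∀ b ∈ S, Reaches ends F a b

/-- A walk from `u` to `w` given by a list of edges. -/
inductive IsWalk (ends : E → Sym2 V) : V → V → List E → Prop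
  | nil (v : V) : IsWalk ends v v []
  | cons {u v w : V} {e : E} {l : List E} :
      ends e = s(u, v) → IsWalk ends v w l → IsWalk ends u w (e :: l)

/-- A path from `u` to `v` using edges of `F` (a walk with no repeated edges). -/
def IsPathIn (ends : E → Sym2 V) (F : Set E) (u v : V) (l : List E) : Prop :=
  IsWalk ends u v l ∧ l.Nodup ∧ ∀ e ∈ l, e ∈ F

/-- There are `n` pairwise edge-disjoint paths from `u` to `v` inside `F`. -/
def EdgeDisjointPathsIn (ends : E → Sym2 V) (F : Set E) (n : ℕ) (u v : V) : Prop :=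
  ∃ P : Fin n → List E, (∀ i, IsPathIn ends F u v (P i)) ∧
    ∀ i j, i ≠ j → ∀ e ∈ P i, e ∉ P j

/-- `S` is `n`-edge-connected in the (sub)graph with edge set `F`:
any two distinct vertices of `S` are joined by `n` edge-disjoint paths. -/
def EdgeConnectedIn (ends : E → Sym2 V) (F : Set E) (S : Set V) (n : ℕ) : Prop :=
  ∀ a ∈ S, ∀ b ∈ S, a ≠ b → EdgeDisjointPathsIn ends F n a b

/-- A family of subgraphs (edge sets) is pairwise edge-disjoint. -/
def PairwiseEdgeDisjoint {k : ℕ} (H : Fin k → Set E) : Prop :=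
  ∀ i j, i ≠ j → Disjoint (H i) (H j)

/-- `v` is a cut vertex of the subgraph with edge set `H`: some two vertices
distinct from `v` are connected in `H` but not after removing `v`. -/
def IsCutVertexOf (ends : E → Sym2 V) (H : Set E) (v : V) : Prop :=
  ∃ a b : V, a ≠ v ∧ b ≠ v ∧ Reaches ends H a b ∧
    ¬ Reaches ends {e ∈ H | v ∉ ends e} a b

/-- A subpartition of `E(v)` into `k` (possibly empty) parts. -/
def IsSubpartitionAt {k : ℕ} (ends : E → Sym2 V) (v : V) (P : Fin k → Set E) : Prop :=
  (∀ i, P i ⊆ incEdges ends v) ∧ ∀ i j, i ≠ j → Disjoint (P i) (P j)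

/-- A balanced partition of `E(v)` into `k` parts: each part has ≥ 2 edges. -/
def IsBalancedPartitionAt {k : ℕ} (ends : E → Sym2 V) (v : V) (P : Fin k → Set E) : Prop :=
  IsSubpartitionAt ends v P ∧ (⋃ i, P i) = incEdges ends v ∧ ∀ i, 2 ≤ (P i).ncard

/-- A balanced subpartition of `E(v)`: one extendable to a balanced partition. -/
def IsBalancedSubpartitionAt {k : ℕ} (ends : E → Sym2 V) (v : V) (P : Fin k → Set E) : Prop :=
  IsSubpartitionAt ends v P ∧
    ∃ P' : Fin k → Set E, IsBalancedPartitionAt ends v P' ∧ ∀ i, P i ⊆ P' i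

/-- The subgraphs `H 1, …, H k` extend the subpartition `P` at `v`:
`P i ⊆ H i` and `v` is not a cut vertex of any `H i`. -/
def Extend {k : ℕ} (ends : E → Sym2 V) (v : V) (P H : Fin k → Set E) : Prop :=
  ∀ i, P i ⊆ H i ∧ ¬ IsCutVertexOf ends (H i) v

/-- The subgraphs `H 1, …, H k` balance the vertex `u`. -/
def BalanceVertex {k : ℕ} (ends : E → Sym2 V) (H : Fin k → Set E) (u : V) : Prop :=
  IsBalancedSubpartitionAt ends u (fun i => incEdges ends u ∩ H i)

/-- The subgraphs `H 1, …, H k` balance every vertex of `T`. -/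
def BalanceSet {k : ℕ} (ends : E → Sym2 V) (H : Fin k → Set E) (T : Set V) : Prop :=
  ∀ u ∈ T, BalanceVertex ends H u

/-- A loopless multigraph. -/
def Loopless (ends : E → Sym2 V) : Prop := ∀ e : E, ¬ (ends e).IsDiag

/-- The set of neighbors of a vertex. -/
def neighbors (ends : E → Sym2 V) (u : V) : Set V := {w | ∃ e, ends e = s(u, w)}

/-- There is no family of `k` pairwise edge-disjoint `S`-subgraphs that
balance `S ∪ R` and extend the subpartition `P` at `v`. -/
def NoGoodPacking {k : ℕ} (ends : E → Sym2 V) (S R : Set V) (v : V)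
    (P : Fin k → Set E) : Prop :=
  ¬ ∃ H : Fin k → Set E, PairwiseEdgeDisjoint H ∧ (∀ i, ConnectsSet ends (H i) S) ∧
      BalanceSet ends H (S ∪ R) ∧ Extend ends v P H

/-- `(G, S, R, v, P, Q, k)` is a counterexample to the Extension Theorem:
it satisfies all hypotheses of the Extension Theorem (including that every
label appears at least twice at `v`), yet admits no good packing. -/
def ExtCex (Q k : ℕ) (ends : E → Sym2 V) (S R : Set V) (v : V)
    (P : Fin k → Set E) : Prop :=
  36 ≤ Q ∧ 0 < k ∧ Disjoint S R ∧ 2 ≤ S.ncard ∧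
  EdgeConnectedIn ends Set.univ S (Q * k) ∧
  (∀ r ∈ R, (Q - 2) * k ≤ deg ends r) ∧
  v ∈ S ∧ (∀ e : E, v ∈ ends e → ¬ (ends e).IsDiag) ∧
  deg ends v = Q * k ∧
  IsBalancedSubpartitionAt ends v P ∧ (∀ i, 2 ≤ (P i).ncard) ∧
  NoGoodPacking ends S R v P

/-- The measure used for minimality: number of vertices plus number of
non-loop edges. -/
noncomputable def extMeasure (ends : E → Sym2 V) : ℕ :=
  Nat.card V + {e : E | ¬ (ends e).IsDiag}.ncard

/-- A minimal counterexample to the Extension Theorem: a counterexample whose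
measure is at most the measure of every counterexample (with the same `Q`, `k`). -/
def MinExtCex (Q k : ℕ) (ends : E → Sym2 V) (S R : Set V) (v : V)
    (P : Fin k → Set E) : Prop :=
  ExtCex Q k ends S R v P ∧
  ∀ (V' E' : Type) (_ : Finite V') (_ : Finite E') (ends' : E' → Sym2 V')
    (S' R' : Set V') (v' : V') (P' : Fin k → Set E'),
    ExtCex Q k ends' S' R' v' P' → extMeasure ends ≤ extMeasure ends'

/-! ### Cuts and Menger's theorem -/

/-- The set of edges with an endpoint in `X` and an endpoint outside `X`. -/
def cut (ends : E → Sym2 V) (X : Set V) : Set E :=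
  {e | (∃ x ∈ ends e, x ∈ X) ∧ ∃ y ∈ ends e, y ∉ X}

theorem cut_compl (ends : E → Sym2 V) (X : Set V) : cut ends Xᶜ = cut ends X := by
  ext e
  simp only [cut, Set.mem_ofPred_eq, Set.mem_compl_iff, not_not]
  exact and_comm

theorem IsWalk.exists_mem_cut {ends : E → Sym2 V} {X : Set V} {a b : V} {l : List E}
    (h : IsWalk ends a b l) (ha : a ∈ X) (hb : b ∉ X) : ∃ e ∈ l, e ∈ cut ends X := by
  induction h with
  | nil => exact absurd ha hb
  | @cons u v w e l he _ ih =>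
    by_cases hv : v ∈ X
    · obtain ⟨e', h1, h2⟩ := ih hv hb
      exact ⟨e', List.mem_cons_of_mem _ h1, h2⟩
    · exact ⟨e, List.mem_cons_self, ⟨u, by simp [he], ha⟩, ⟨v, by simp [he], hv⟩⟩

theorem EdgeDisjointPathsIn.le_ncard_cut [Finite E] {ends : E → Sym2 V} {F : Set E} {X : Set V}
    {a b : V} {n : ℕ} (h : EdgeDisjointPathsIn ends F n a b) (ha : a ∈ X) (hb : b ∉ X) :
    n ≤ (cut ends X).ncard := by
  obtain ⟨p, hp, hdisj⟩ := h
  choose g hg hgc using fun i => (hp i).1.exists_mem_cut ha hb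
  have hinj : Function.Injective g := by
    intro i j hij
    by_contra hne
    exact hdisj i j hne (g i) (hg i) (hij ▸ hg j)
  calc n = (Set.range g).ncard := by
        rw [← Set.image_univ, Set.ncard_image_of_injective _ hinj, Set.ncard_univ, Nat.card_fin]
    _ ≤ _ := Set.ncard_le_ncard (by rintro _ ⟨i, rfl⟩; exact hgc i) (Set.toFinite _)

/-- The vertices from which `b` can be reached in at most `n` steps of `r`. -/
def stepsTo (r : V → V → Prop) (b : V) : ℕ → Set V
  | 0 => {b}
  | n + 1 => stepsTo r b n ∪ {y | ∃ z ∈ stepsTo r b n, r y z}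

open Classical in
/-- The net outflow at `x` of the flow `φ` along the edges `e` oriented from `tl e` to `hd e`. -/
noncomputable def netFlow [Fintype E] (tl hd : E → V) (φ : E → ℤ) (x : V) : ℤ :=
  ∑ e, φ e * ((if tl e = x then 1 else 0) - (if hd e = x then 1 else 0))

section Flow

variable [Fintype E] {tl hd : E → V}

open Classical in
theorem netFlow_update (φ : E → ℤ) (e : E) (c : ℤ) (x : V) :
    netFlow tl hd (Function.update φ e c) x = netFlow tl hd φ x +
      (c - φ e) * ((if tl e = x then 1 else 0) - (if hd e = x then 1 else 0)) := by
  unfold netFlow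
  rw [← Finset.add_sum_erase _ _ (Finset.mem_univ e),
    ← Finset.add_sum_erase _ (fun e => φ e * _) (Finset.mem_univ e)]
  have : ∑ e' ∈ Finset.univ.erase e, Function.update φ e c e' *
      ((if tl e' = x then (1 : ℤ) else 0) - (if hd e' = x then 1 else 0)) =
      ∑ e' ∈ Finset.univ.erase e, φ e' *
      ((if tl e' = x then (1 : ℤ) else 0) - (if hd e' = x then 1 else 0)) := by
    refine Finset.sum_congr rfl fun e' he' => ?_
    rw [Function.update_of_ne (Finset.ne_of_mem_erase he')]
  rw [this, Function.update_self]
  ring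

open Classical in
theorem sum_netFlow [Fintype V] (φ : E → ℤ) (U : Set V) :
    ∑ x with x ∉ U, netFlow tl hd φ x =
      ∑ e, φ e * ((if tl e ∉ U then 1 else 0) - (if hd e ∉ U then 1 else 0)) := by
  unfold netFlow
  rw [Finset.sum_comm]
  refine Finset.sum_congr rfl fun e _ => ?_
  rw [← Finset.mul_sum, Finset.sum_sub_distrib]
  simp [Finset.sum_ite_eq]

open Classical in
theorem sum_netFlow_eq [Fintype V] {φ : E → ℤ} {a b : V} {U : Set V} (ha : a ∉ U) (hb : b ∈ U)
    (h0 : ∀ x, x ≠ a → x ≠ b → netFlow tl hd φ x = 0) :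
    ∑ x with x ∉ U, netFlow tl hd φ x = netFlow tl hd φ a := by
  refine Finset.sum_eq_single a (fun x hx hxa => h0 x hxa ?_) (fun h => ?_)
  · rintro rfl
    simp [hb] at hx
  · simp [ha] at h

/-- `φ` admits one more unit of flow from `y` to `z` along some edge. -/
def Residual (tl hd : E → V) (φ : E → ℤ) (y z : V) : Prop :=
  ∃ e, (tl e = y ∧ hd e = z ∧ φ e < 1) ∨ (hd e = y ∧ tl e = z ∧ -1 < φ e)

open Classical in
theorem exists_push {φ : E → ℤ} {b : V} (hφ : ∀ e, |φ e| ≤ 1) (n : ℕ) :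
    ∀ y ∈ stepsTo (Residual tl hd φ) b n, ∃ φ' : E → ℤ, (∀ e, |φ' e| ≤ 1) ∧
      (∀ x, netFlow tl hd φ' x = netFlow tl hd φ x + (if y = x then 1 else 0) -
        (if b = x then 1 else 0)) ∧
      ∀ e, (tl e ∉ stepsTo (Residual tl hd φ) b n ∨ hd e ∉ stepsTo (Residual tl hd φ) b n) →
        φ' e = φ e := by
  induction n with
  | zero =>
    rintro y rfl
    exact ⟨φ, hφ, by simp, by simp⟩
  | succ n ih =>
    intro y hy
    by_cases hyn : y ∈ stepsTo (Residual tl hd φ) b n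
    · obtain ⟨φ', h1, h2, h3⟩ := ih y hyn
      refine ⟨φ', h1, h2, fun e he => h3 e ?_⟩
      exact he.imp (fun h h' => h (Or.inl h')) (fun h h' => h (Or.inl h'))
    obtain hy | ⟨z, hz, e, he⟩ := hy
    · exact absurd hy hyn
    obtain ⟨φ', h1, h2, h3⟩ := ih z hz
    have hab := abs_le.1 (hφ e)
    obtain ⟨c, hc, hnet⟩ : ∃ c : ℤ, |c| ≤ 1 ∧ ∀ x, (c - φ e) *
        ((if tl e = x then (1 : ℤ) else 0) - (if hd e = x then 1 else 0)) =
        (if y = x then 1 else 0) - (if z = x then 1 else 0) := by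
      obtain ⟨rfl, rfl, h⟩ | ⟨rfl, rfl, h⟩ := he
      · exact ⟨φ e + 1, abs_le.2 ⟨by omega, by omega⟩, fun x => by ring⟩
      · exact ⟨φ e - 1, abs_le.2 ⟨by omega, by omega⟩, fun x => by ring⟩
    have hee : φ' e = φ e := by
      apply h3
      obtain ⟨rfl, -, -⟩ | ⟨rfl, -, -⟩ := he
      · exact Or.inl hyn
      · exact Or.inr hyn
    refine ⟨Function.update φ' e c, fun e' => ?_, fun x => ?_, fun e' he' => ?_⟩
    · by_cases h : e' = e
      · subst h; simpa using hc
      · rw [Function.update_of_ne h]; exact h1 e'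
    · rw [netFlow_update, h2, hee, hnet]; ring
    · have hne : e' ≠ e := by
        rintro rfl
        have hyy : y ∈ stepsTo (Residual tl hd φ) b (n + 1) :=
          Or.inr ⟨z, hz, e', he⟩
        have hzz : z ∈ stepsTo (Residual tl hd φ) b (n + 1) := Or.inl hz
        obtain ⟨rfl, rfl, -⟩ | ⟨rfl, rfl, -⟩ := he
        · exact he'.elim (fun h => h hyy) (fun h => h hzz)
        · exact he'.elim (fun h => h hzz) (fun h => h hyy)
      rw [Function.update_of_ne hne]
      exact h3 e' (he'.imp (fun h h' => h (Or.inl h')) (fun h h' => h (Or.inl h')))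

theorem exists_flow [Fintype V] {ends : E → Sym2 V} (hends : ∀ e, ends e = s(tl e, hd e))
    {a b : V} (hab : a ≠ b) {n : ℕ}
    (hcut : ∀ X : Set V, a ∈ X → b ∉ X → n ≤ (cut ends X).ncard) :
    ∀ m ≤ n, ∃ φ : E → ℤ, (∀ e, |φ e| ≤ 1) ∧ (∀ x, x ≠ a → x ≠ b → netFlow tl hd φ x = 0) ∧
      netFlow tl hd φ a = m := by
  classical
  intro m
  induction m with
  | zero => exact fun _ => ⟨0, by simp, by simp [netFlow], by simp [netFlow]⟩
  | succ m ih =>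
    intro hm
    obtain ⟨φ, hφ, h0, ha⟩ := ih (by omega)
    by_cases hU : ∃ i, a ∈ stepsTo (Residual tl hd φ) b i
    · obtain ⟨i, hi⟩ := hU
      obtain ⟨φ', h1, h2, -⟩ := exists_push hφ i a hi
      refine ⟨φ', h1, fun x hxa hxb => ?_, ?_⟩
      · rw [h2, h0 x hxa hxb]; simp [Ne.symm hxa, Ne.symm hxb]
      · rw [h2, ha]; simp [Ne.symm hab]
    exfalso
    set U : Set V := {x | ∃ i, x ∈ stepsTo (Residual tl hd φ) b i} with hUdef
    have hb : b ∈ U := ⟨0, rfl⟩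
    have hclosed : ∀ y z, z ∈ U → Residual tl hd φ y z → y ∈ U := fun y z ⟨i, hi⟩ hr =>
      ⟨i + 1, Or.inr ⟨z, hi, hr⟩⟩
    have hsum := sum_netFlow_eq (tl := tl) (hd := hd) hU hb h0
    rw [sum_netFlow, ha] at hsum
    have hterm : ∀ e, φ e * ((if tl e ∉ U then (1 : ℤ) else 0) - (if hd e ∉ U then 1 else 0)) =
        if e ∈ cut ends Uᶜ then 1 else 0 := by
      intro e
      have hbd := abs_le.1 (hφ e)
      by_cases h1 : tl e ∈ U <;> by_cases h2 : hd e ∈ U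
      · simp [cut, hends, h1, h2]
      · have : ¬ -1 < φ e := fun h => h2 (hclosed _ _ h1 ⟨e, Or.inr ⟨rfl, rfl, h⟩⟩)
        have : φ e = -1 := by omega
        simp [cut, hends, h1, h2, this]
      · have : ¬ φ e < 1 := fun h => h1 (hclosed _ _ h2 ⟨e, Or.inl ⟨rfl, rfl, h⟩⟩)
        have : φ e = 1 := by omega
        simp [cut, hends, h1, h2, this]
      · simp [cut, hends, h1, h2]
    rw [Finset.sum_congr rfl fun e _ => hterm e, Finset.sum_boole] at hsum
    have := hcut Uᶜ hU (by simpa using hb)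
    rw [Set.ncard_eq_toFinset_card', Set.toFinset_card] at this
    rw [← Fintype.card_subtype] at hsum
    have h3 : Fintype.card {x // x ∈ cut ends Uᶜ} = m := by exact_mod_cast hsum
    have h4 : Fintype.card ↑(cut ends Uᶜ) = Fintype.card {x // x ∈ cut ends Uᶜ} :=
      Fintype.card_congr (Equiv.refl _)
    omega

/-- `φ` sends a unit of flow from `y` to `z` along some edge. -/
def FlowStep (tl hd : E → V) (φ : E → ℤ) (y z : V) : Prop :=
  ∃ e, (tl e = y ∧ hd e = z ∧ φ e = 1) ∨ (hd e = y ∧ tl e = z ∧ φ e = -1)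

open Classical in
theorem exists_flow_path {ends : E → Sym2 V} (hends : ∀ e, ends e = s(tl e, hd e))
    {φ : E → ℤ} {b : V} (n : ℕ) :
    ∀ y ∈ stepsTo (FlowStep tl hd φ) b n, ∃ l : List E, IsWalk ends y b l ∧ l.Nodup ∧
      (∀ e ∈ l, φ e ≠ 0 ∧ tl e ∈ stepsTo (FlowStep tl hd φ) b n ∧
        hd e ∈ stepsTo (FlowStep tl hd φ) b n) ∧
      ∀ x, netFlow tl hd (fun e => if e ∈ l then 0 else φ e) x =
        netFlow tl hd φ x - (if y = x then 1 else 0) + (if b = x then 1 else 0) := by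
  induction n with
  | zero =>
    rintro y rfl
    exact ⟨[], .nil _, by simp, by simp, by simp⟩
  | succ n ih =>
    intro y hy
    by_cases hyn : y ∈ stepsTo (FlowStep tl hd φ) b n
    · obtain ⟨l, h1, h2, h3, h4⟩ := ih y hyn
      exact ⟨l, h1, h2, fun e he => ⟨(h3 e he).1, Or.inl (h3 e he).2.1, Or.inl (h3 e he).2.2⟩, h4⟩
    obtain hy | ⟨z, hz, e, he⟩ := hy
    · exact absurd hy hyn
    obtain ⟨l, h1, h2, h3, h4⟩ := ih z hz
    have hyy : y ∈ stepsTo (FlowStep tl hd φ) b (n + 1) := Or.inr ⟨z, hz, e, he⟩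
    have hzz : z ∈ stepsTo (FlowStep tl hd φ) b (n + 1) := Or.inl hz
    have hel : e ∉ l := by
      intro h
      obtain ⟨rfl, -, -⟩ | ⟨rfl, -, -⟩ := he
      · exact hyn (h3 e h).2.1
      · exact hyn (h3 e h).2.2
    have hupd : (fun e' => if e' ∈ e :: l then 0 else φ e') =
        Function.update (fun e' => if e' ∈ l then 0 else φ e') e 0 := by
      funext e'
      by_cases h : e' = e
      · subst h; simp
      · simp [h]
    refine ⟨e :: l, .cons ?_ h1, List.nodup_cons.2 ⟨hel, h2⟩, ?_, fun x => ?_⟩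
    · obtain ⟨rfl, rfl, -⟩ | ⟨rfl, rfl, -⟩ := he
      · exact hends e
      · rw [hends e, Sym2.eq_swap]
    · intro e' he'
      obtain rfl | he' := List.mem_cons.1 he'
      · obtain ⟨rfl, rfl, h⟩ | ⟨rfl, rfl, h⟩ := he
        · exact ⟨by simp [h], hyy, hzz⟩
        · exact ⟨by simp [h], hzz, hyy⟩
      · exact ⟨(h3 e' he').1, Or.inl (h3 e' he').2.1, Or.inl (h3 e' he').2.2⟩
    · rw [hupd, netFlow_update, h4]
      simp only [hel, if_false]
      obtain ⟨rfl, rfl, h⟩ | ⟨rfl, rfl, h⟩ := he <;> rw [h] <;> ring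

theorem exists_paths_of_flow [Fintype V] {ends : E → Sym2 V}
    (hends : ∀ e, ends e = s(tl e, hd e)) {a b : V} (hab : a ≠ b) (m : ℕ) :
    ∀ φ : E → ℤ, (∀ e, |φ e| ≤ 1) → (∀ x, x ≠ a → x ≠ b → netFlow tl hd φ x = 0) →
      netFlow tl hd φ a = m →
      ∃ p : Fin m → List E, (∀ i, IsWalk ends a b (p i) ∧ (p i).Nodup ∧ ∀ e ∈ p i, φ e ≠ 0) ∧
        ∀ i j, i ≠ j → ∀ e ∈ p i, e ∉ p j := by
  classical
  induction m with
  | zero => exact fun φ _ _ _ => ⟨Fin.elim0, fun i => i.elim0, fun i => i.elim0⟩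
  | succ m ih =>
    intro φ hφ h0 ha
    by_cases hU : ∃ i, a ∈ stepsTo (FlowStep tl hd φ) b i
    · obtain ⟨i, hi⟩ := hU
      obtain ⟨l, h1, h2, h3, h4⟩ := exists_flow_path hends i a hi
      obtain ⟨p, hp, hd⟩ := ih (fun e => if e ∈ l then 0 else φ e)
        (fun e => by split_ifs <;> simp [hφ])
        (fun x hxa hxb => by rw [h4, h0 x hxa hxb]; simp [Ne.symm hxa, Ne.symm hxb])
        (by rw [h4, ha]; simp [Ne.symm hab])
      have hpl : ∀ i, ∀ e ∈ p i, e ∉ l ∧ φ e ≠ 0 := fun i e he => by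
        simpa using (hp i).2.2 e he
      refine ⟨Fin.cons l p, fun i => ?_, fun i j hij => ?_⟩
      · refine Fin.cases ⟨h1, h2, fun e he => (h3 e he).1⟩ (fun i => ?_) i
        exact ⟨(hp i).1, (hp i).2.1, fun e he => (hpl i e he).2⟩
      · induction i using Fin.cases with
        | zero =>
          induction j using Fin.cases with
          | zero => exact absurd rfl hij
          | succ j => exact fun e he he' => (hpl j e he').1 he
        | succ i =>
          induction j using Fin.cases with
          | zero => exact fun e he => (hpl i e he).1
          | succ j => exact hd i j (fun h => hij (h ▸ rfl))
    exfalso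
    set U : Set V := {x | ∃ i, x ∈ stepsTo (FlowStep tl hd φ) b i} with hUdef
    have hb : b ∈ U := ⟨0, rfl⟩
    have hclosed : ∀ y z, z ∈ U → FlowStep tl hd φ y z → y ∈ U := fun y z ⟨i, hi⟩ hr =>
      ⟨i + 1, Or.inr ⟨z, hi, hr⟩⟩
    have hsum := sum_netFlow_eq (tl := tl) (hd := hd) hU hb h0
    rw [sum_netFlow, ha] at hsum
    have hterm : ∀ e, φ e * ((if tl e ∉ U then (1 : ℤ) else 0) - (if hd e ∉ U then 1 else 0)) ≤
        0 := by
      intro e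
      have hbd := abs_le.1 (hφ e)
      by_cases h1 : tl e ∈ U <;> by_cases h2 : hd e ∈ U
      · simp [h1, h2]
      · have : φ e ≠ -1 := fun h => h2 (hclosed _ _ h1 ⟨e, Or.inr ⟨rfl, rfl, h⟩⟩)
        simp [h1, h2]; omega
      · have : φ e ≠ 1 := fun h => h1 (hclosed _ _ h2 ⟨e, Or.inl ⟨rfl, rfl, h⟩⟩)
        simp [h1, h2]; omega
      · simp [h1, h2]
    have := Finset.sum_nonpos fun e (_ : e ∈ Finset.univ) => hterm e
    rw [hsum] at this
    push_cast at this
    omega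

end Flow

/-- Menger's theorem for a set of terminals: edge-connectivity is a condition on cuts. -/
theorem edgeConnectedIn_univ_iff [Finite V] [Finite E] {ends : E → Sym2 V} {S : Set V} {n : ℕ} :
    EdgeConnectedIn ends Set.univ S n ↔
      ∀ X : Set V, (∃ a ∈ S, a ∈ X) → (∃ b ∈ S, b ∉ X) → n ≤ (cut ends X).ncard := by
  constructor
  · rintro h X ⟨a, ha, haX⟩ ⟨b, hb, hbX⟩
    exact (h a ha b hb (by rintro rfl; exact hbX haX)).le_ncard_cut haX hbX
  · intro h a ha b hb hab
    have := Fintype.ofFinite V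
    have := Fintype.ofFinite E
    have hends : ∀ e, ∃ p : V × V, ends e = s(p.1, p.2) := fun e =>
      Sym2.ind (f := fun z => ∃ p : V × V, z = s(p.1, p.2)) (fun x y => ⟨(x, y), rfl⟩) (ends e)
    choose p hp using hends
    obtain ⟨φ, h1, h2, h3⟩ := exists_flow (tl := fun e => (p e).1) (hd := fun e => (p e).2) hp hab
      (fun X haX hbX => h X ⟨a, ha, haX⟩ ⟨b, hb, hbX⟩) n le_rfl
    obtain ⟨q, hq, hdisj⟩ := exists_paths_of_flow hp hab n φ h1 h2 h3
    exact ⟨q, fun i => ⟨(hq i).1, (hq i).2.1, fun _ _ => trivial⟩, hdisj⟩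

/-! ### Reachability and balanced partitions -/

theorem Step.symm {ends : E → Sym2 V} {F : Set E} {a b : V} (h : Step ends F a b) :
    Step ends F b a := by
  obtain ⟨e, he, heq⟩ := h
  exact ⟨e, he, heq.trans Sym2.eq_swap⟩

theorem Reaches.symm {ends : E → Sym2 V} {F : Set E} {a b : V} (h : Reaches ends F a b) :
    Reaches ends F b a := by
  induction h with
  | refl => exact Relation.ReflTransGen.refl
  | tail _ h ih => exact ih.head h.symm

theorem Reaches.lift {V' E' : Type} {ends : E → Sym2 V} {ends' : E' → Sym2 V'} {F : Set E}
    {F' : Set E'} (f : V → V') {a b : V} (h : Reaches ends F a b)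
    (hstep : ∀ p q, ∀ e ∈ F, ends e = s(p, q) → Reaches ends' F' (f p) (f q)) :
    Reaches ends' F' (f a) (f b) := by
  induction h with
  | refl => exact Relation.ReflTransGen.refl
  | tail _ h ih =>
    obtain ⟨e, he, heq⟩ := h
    exact ih.trans (hstep _ _ e he heq)

theorem Reaches.of_edge {ends : E → Sym2 V} {F : Set E} {a b : V} {e : E} (he : e ∈ F)
    (heq : ends e = s(a, b)) : Reaches ends F a b :=
  Relation.ReflTransGen.single ⟨e, he, heq⟩

theorem Reaches.mono {ends : E → Sym2 V} {F F' : Set E} {a b : V} (h : Reaches ends F a b)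
    (hF : F ⊆ F') : Reaches ends F' a b :=
  h.lift id fun _ _ _ he heq => Reaches.of_edge (hF he) heq

theorem BalanceVertex.mono [Finite E] {k : ℕ} (hk : 0 < k) {ends ends' : E → Sym2 V}
    {H H' : Fin k → Set E} {x : V} (h : BalanceVertex ends' H' x)
    (hinc : incEdges ends' x ⊆ incEdges ends x)
    (hH : ∀ i, incEdges ends x ∩ H i ⊆ incEdges ends' x ∩ H' i) : BalanceVertex ends H x := by
  obtain ⟨⟨-, hdisj⟩, P, ⟨⟨hP1, hP2⟩, hP3, hP4⟩, hHP⟩ := h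
  refine ⟨⟨fun i => Set.inter_subset_left, fun i j hij => (hdisj i j hij).mono (hH i) (hH j)⟩,
    fun i => P i ∪ {e | i = ⟨0, hk⟩ ∧ e ∈ incEdges ends x ∧ e ∉ incEdges ends' x},
    ⟨⟨fun i => ?_, fun i j hij => ?_⟩, ?_, fun i => ?_⟩, fun i => ?_⟩
  · rintro e (he | he)
    · exact hinc (hP1 i he)
    · exact he.2.1
  · rw [Set.disjoint_left]
    rintro e (he | he) (he' | he')
    · exact Set.disjoint_left.1 (hP2 i j hij) he he'
    · exact he'.2.2 (hP1 i he)
    · exact he.2.2 (hP1 j he')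
    · exact hij (he.1.trans he'.1.symm)
  · ext e
    simp only [Set.mem_iUnion, Set.mem_union]
    constructor
    · rintro ⟨i, he | he⟩
      · exact hinc (hP1 i he)
      · exact he.2.1
    · intro he
      by_cases he' : e ∈ incEdges ends' x
      · rw [← hP3, Set.mem_iUnion] at he'
        obtain ⟨i, hi⟩ := he'
        exact ⟨i, Or.inl hi⟩
      · exact ⟨⟨0, hk⟩, Or.inr ⟨rfl, he, he'⟩⟩
  · exact (hP4 i).trans (Set.ncard_le_ncard Set.subset_union_left (Set.toFinite _))
  · exact (hH i).trans ((hHP i).trans Set.subset_union_left)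

theorem exists_isBalancedPartitionAt [Finite E] {k : ℕ} (hk : 0 < k) {ends : E → Sym2 V} {x : V}
    (h : 2 * k ≤ deg ends x) : ∃ P : Fin k → Set E, IsBalancedPartitionAt ends x P := by
  classical
  have := Fintype.ofFinite E
  have hcard : Fintype.card (Fin k × Fin 2) ≤ Fintype.card ↑(incEdges ends x) := by
    rw [Fintype.card_prod, Fintype.card_fin, Fintype.card_fin, ← Nat.card_eq_fintype_card,
      Nat.card_coe_set_eq, mul_comm]
    exact h
  obtain ⟨g⟩ := Function.Embedding.nonempty_of_card_le hcard
  let label : E → Fin k := fun e =>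
    if h : ∃ p, (g p : E) = e then h.choose.1 else ⟨0, hk⟩
  have hlabel : ∀ p, label (g p) = p.1 := fun p => by
    have hex : ∃ p', (g p' : E) = g p := ⟨p, rfl⟩
    have hl : label (g p) = hex.choose.1 := dif_pos hex
    rw [hl, g.injective (Subtype.ext hex.choose_spec)]
  refine ⟨fun i => {e | e ∈ incEdges ends x ∧ label e = i}, ⟨fun i e he => he.1, ?_⟩, ?_, ?_⟩
  · intro i j hij
    rw [Set.disjoint_left]
    exact fun e he he' => hij (he.2.symm.trans he'.2)
  · ext e
    simp
  · intro i
    have hne : (g (i, 0) : E) ≠ g (i, 1) := fun h => by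
      simpa using g.injective (Subtype.ext h)
    rw [← Set.ncard_pair hne]
    refine Set.ncard_le_ncard ?_ (Set.toFinite _)
    rintro e (rfl | rfl)
    · exact ⟨(g _).2, hlabel _⟩
    · exact ⟨(g _).2, hlabel _⟩

theorem IsBalancedPartitionAt.isBalancedSubpartitionAt {k : ℕ} {ends : E → Sym2 V} {x : V}
    {P : Fin k → Set E} (h : IsBalancedPartitionAt ends x P) :
    IsBalancedSubpartitionAt ends x P :=
  ⟨h.1, P, h, fun _ => subset_rfl⟩

/-! ### Contractions -/

open Classical in
/-- The map contracting the vertex set `X` to `x₀`. -/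
noncomputable def collapse (X : Set V) (x₀ : V) (x : V) : V := if x ∈ X then x₀ else x

open Classical in
/-- The multigraph obtained by contracting `X` to `x₀`, where the edges inside `X` and the
self-loops at `z` are turned into self-loops at `x₁`. -/
noncomputable def contract (ends : E → Sym2 V) (X : Set V) (x₀ x₁ z : V) (e : E) : Sym2 V :=
  if (∀ x ∈ ends e, x ∈ X) ∨ ends e = s(z, z) then s(x₁, x₁) else (ends e).map (collapse X x₀)

section Contract

variable {ends : E → Sym2 V} {X : Set V} {x₀ x₁ z : V}

theorem collapse_of_mem {x : V} (h : x ∈ X) : collapse X x₀ x = x₀ := if_pos h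

theorem collapse_of_notMem {x : V} (h : x ∉ X) : collapse X x₀ x = x := if_neg h

theorem collapse_eq_iff_of_notMem (hx₀ : x₀ ∈ X) {x y : V} (hy : y ∉ X) :
    collapse X x₀ x = y ↔ x = y := by
  by_cases hx : x ∈ X
  · rw [collapse_of_mem hx]
    exact ⟨fun h => absurd (h ▸ hx₀) hy, fun h => absurd (h ▸ hx) hy⟩
  · rw [collapse_of_notMem hx]

theorem collapse_eq_self_iff (hx₀ : x₀ ∈ X) {x : V} : collapse X x₀ x = x₀ ↔ x ∈ X := by
  by_cases hx : x ∈ X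
  · simp [collapse_of_mem hx, hx]
  · rw [collapse_of_notMem hx]
    exact ⟨fun h => h ▸ hx₀, fun h => absurd h hx⟩

theorem collapse_eq_collapse (hx₀ : x₀ ∈ X) {x y : V}
    (h : collapse X x₀ x = collapse X x₀ y) : x = y ∨ x ∈ X ∧ y ∈ X := by
  by_cases hy : y ∈ X
  · rw [collapse_of_mem hy, collapse_eq_self_iff hx₀] at h
    exact Or.inr ⟨h, hy⟩
  · rw [collapse_of_notMem hy, collapse_eq_iff_of_notMem hx₀ hy] at h
    exact Or.inl h

theorem collapse_ne (h₀₁ : x₀ ≠ x₁) (hx₁ : x₁ ∈ X) (x : V) : collapse X x₀ x ≠ x₁ := by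
  by_cases hx : x ∈ X
  · rwa [collapse_of_mem hx]
  · rw [collapse_of_notMem hx]
    rintro rfl
    exact hx hx₁

theorem contract_of_inside {e : E} (h : ∀ x ∈ ends e, x ∈ X) :
    contract ends X x₀ x₁ z e = s(x₁, x₁) := if_pos (Or.inl h)

theorem contract_of_not {e : E} (h : ¬ ∀ x ∈ ends e, x ∈ X) (h' : ends e ≠ s(z, z)) :
    contract ends X x₀ x₁ z e = (ends e).map (collapse X x₀) := if_neg (not_or.2 ⟨h, h'⟩)

theorem mem_of_mem_contract (hx₀ : x₀ ∈ X) (hx₁ : x₁ ∈ X) {r : V} (hr : r ∉ X) {e : E}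
    (h : r ∈ contract ends X x₀ x₁ z e) : r ∈ ends e := by
  by_cases h1 : (∀ x ∈ ends e, x ∈ X) ∨ ends e = s(z, z)
  · rw [contract, if_pos h1, Sym2.mem_iff, or_self] at h
    exact absurd (h ▸ hx₁) hr
  · rw [contract, if_neg h1, Sym2.mem_map] at h
    obtain ⟨p, hp, hpr⟩ := h
    rw [collapse_eq_iff_of_notMem hx₀ hr] at hpr
    exact hpr ▸ hp

theorem mem_contract_of_mem {r : V} (hr : r ∉ X) {e : E} (hloop : ends e ≠ s(z, z))
    (h : r ∈ ends e) : r ∈ contract ends X x₀ x₁ z e := by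
  rw [contract_of_not (fun h' => hr (h' r h)) hloop, Sym2.mem_map]
  exact ⟨r, h, collapse_of_notMem hr⟩

theorem incEdges_contract_subset (hx₀ : x₀ ∈ X) (hx₁ : x₁ ∈ X) {r : V} (hr : r ∉ X) :
    incEdges (contract ends X x₀ x₁ z) r ⊆ incEdges ends r :=
  fun _ h => mem_of_mem_contract hx₀ hx₁ hr h

theorem incEdges_contract (hx₀ : x₀ ∈ X) (hx₁ : x₁ ∈ X) {r : V} (hr : r ∉ X)
    (hloop : ∀ e, r ∈ ends e → ends e ≠ s(z, z)) :
    incEdges (contract ends X x₀ x₁ z) r = incEdges ends r :=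
  (incEdges_contract_subset hx₀ hx₁ hr).antisymm
    fun e h => mem_contract_of_mem hr (hloop e h) h

theorem cut_contract (Y : Set V) :
    cut (contract ends X x₀ x₁ z) Y = cut ends (collapse X x₀ ⁻¹' Y) := by
  ext e
  by_cases h1 : (∀ x ∈ ends e, x ∈ X) ∨ ends e = s(z, z)
  · have h2 : e ∉ cut (contract ends X x₀ x₁ z) Y := by
      rintro ⟨⟨x, hx, hxY⟩, y, hy, hyY⟩
      rw [contract, if_pos h1, Sym2.mem_iff, or_self] at hx hy
      exact hyY (hy ▸ hx ▸ hxY)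
    have h3 : e ∉ cut ends (collapse X x₀ ⁻¹' Y) := by
      rintro ⟨⟨x, hx, hxY⟩, y, hy, hyY⟩
      obtain h1 | h1 := h1
      · rw [Set.mem_preimage, collapse_of_mem (h1 _ ‹_›)] at hxY hyY
        exact hyY hxY
      · rw [h1, Sym2.mem_iff, or_self] at hx hy
        exact hyY (hy ▸ hx ▸ hxY)
    exact iff_of_false h2 h3
  · simp only [cut, contract, if_neg h1, Set.mem_ofPred_eq, Sym2.mem_map, Set.mem_preimage]
    constructor
    · rintro ⟨⟨_, ⟨x, hx, rfl⟩, hxY⟩, _, ⟨y, hy, rfl⟩, hyY⟩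
      exact ⟨⟨x, hx, hxY⟩, y, hy, hyY⟩
    · rintro ⟨⟨x, hx, hxY⟩, y, hy, hyY⟩
      exact ⟨⟨_, ⟨x, hx, rfl⟩, hxY⟩, _, ⟨y, hy, rfl⟩, hyY⟩

theorem incEdges_eq_cut {ends : E → Sym2 V} {x : V} (h : ∀ e, x ∈ ends e → ends e ≠ s(x, x)) :
    incEdges ends x = cut ends {x} := by
  ext e
  constructor
  · intro he
    refine ⟨⟨x, he, rfl⟩, ?_⟩
    obtain ⟨y, hy⟩ := Sym2.mem_iff_exists.1 he
    refine ⟨y, by simp [hy], ?_⟩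
    rintro rfl
    exact h e he hy
  · rintro ⟨⟨y, hy, rfl⟩, -⟩
    exact hy

theorem contract_ne_loop (hx₀ : x₀ ∈ X) (hx₁ : x₁ ∈ X) (h₀₁ : x₀ ≠ x₁) {x : V}
    (hx : x = x₀ ∨ x = z ∧ z ∉ X) (e : E) : contract ends X x₀ x₁ z e ≠ s(x, x) := by
  intro heq
  by_cases h1 : (∀ x ∈ ends e, x ∈ X) ∨ ends e = s(z, z)
  · rw [contract, if_pos h1, Sym2.eq_iff] at heq
    obtain rfl : x₁ = x := by tauto
    obtain h | ⟨rfl, h⟩ := hx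
    · exact h₀₁ h.symm
    · exact h hx₁
  · rw [contract, if_neg h1] at heq
    rw [not_or] at h1
    have hall : ∀ p ∈ ends e, collapse X x₀ p = x := fun p hp => by
      have : collapse X x₀ p ∈ s(x, x) := heq ▸ Sym2.mem_map.2 ⟨p, hp, rfl⟩
      simpa using this
    obtain rfl | ⟨rfl, h⟩ := hx
    · exact h1.1 fun p hp => (collapse_eq_self_iff hx₀).1 (hall p hp)
    · refine h1.2 ?_
      have hall' : ∀ p ∈ ends e, p = x := fun p hp =>
        (collapse_eq_iff_of_notMem hx₀ h).1 (hall p hp)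
      generalize ends e = t at hall'
      induction t with
      | _ p q => rw [hall' p (by simp), hall' q (by simp)]

theorem incEdges_contract_eq_cut (hx₀ : x₀ ∈ X) (hx₁ : x₁ ∈ X) (h₀₁ : x₀ ≠ x₁) {x : V}
    (hx : x = x₀ ∨ x = z ∧ z ∉ X) :
    incEdges (contract ends X x₀ x₁ z) x = cut ends (collapse X x₀ ⁻¹' {x}) := by
  rw [incEdges_eq_cut fun e _ => contract_ne_loop hx₀ hx₁ h₀₁ hx e, cut_contract]

theorem preimage_collapse_self (hx₀ : x₀ ∈ X) : collapse X x₀ ⁻¹' {x₀} = X := by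
  ext x
  exact collapse_eq_self_iff hx₀

theorem preimage_collapse_of_notMem (hx₀ : x₀ ∈ X) {y : V} (hy : y ∉ X) :
    collapse X x₀ ⁻¹' {y} = {y} := by
  ext x
  exact collapse_eq_iff_of_notMem hx₀ hy

theorem ncard_nonloop_contract_lt [Finite E] {e₀ : E} (h1 : ∀ x ∈ ends e₀, x ∈ X)
    (h2 : ¬ (ends e₀).IsDiag) :
    {e | ¬ (contract ends X x₀ x₁ z e).IsDiag}.ncard < {e | ¬ (ends e).IsDiag}.ncard := by
  refine Set.ncard_lt_ncard ⟨fun e he hd => he ?_, fun h => h h2 ?_⟩ (Set.toFinite _)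
  · by_cases h3 : (∀ x ∈ ends e, x ∈ X) ∨ ends e = s(z, z)
    · rw [contract, if_pos h3]; rfl
    · rw [contract, if_neg h3]
      generalize ends e = t at hd
      induction t with
      | _ p q =>
        rw [Sym2.mk_isDiag_iff] at hd
        subst hd
        rfl
  · rw [contract_of_inside h1]; rfl

/-- Walks in a contraction lift, provided the ends of the edges attached to the contracted set
are reachable from each other. -/
theorem Reaches.of_contract (hx₀ : x₀ ∈ X) (hx₁ : x₁ ∈ X) (h₀₁ : x₀ ≠ x₁) {H₁ H : Set E}
    {T : Set V} (hT : ∀ t ∈ T, ∀ t' ∈ T, Reaches ends H t t')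
    (hatt : ∀ e ∈ H₁, (¬ ∀ x ∈ ends e, x ∈ X) → ∀ x ∈ ends e, x ∈ X → x ∈ T)
    (hH : ∀ e ∈ H₁, (¬ ∀ x ∈ ends e, x ∈ X) → ends e ≠ s(z, z) → e ∈ H) {p q : V}
    (hpq : Reaches (contract ends X x₀ x₁ z) H₁ p q) {p' : V} (hp'T : p' ∈ X → p' ∈ T)
    (hp' : collapse X x₀ p' = p) :
    ∀ q', (q' ∈ X → q' ∈ T) → collapse X x₀ q' = q → Reaches ends H p' q' := by
  have hfib : ∀ a b, (a ∈ X → a ∈ T) → (b ∈ X → b ∈ T) → collapse X x₀ a = collapse X x₀ b →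
      Reaches ends H a b := by
    intro a b ha hb hab
    obtain rfl | ⟨h1, h2⟩ := collapse_eq_collapse hx₀ hab
    · exact Relation.ReflTransGen.refl
    · exact hT a (ha h1) b (hb h2)
  induction hpq with
  | refl => exact fun q' hq'T hq' => hfib _ _ hp'T hq'T (hp'.trans hq'.symm)
  | @tail c q _ hstep ih =>
    intro q' hq'T hq'
    obtain ⟨e, he, heq⟩ := hstep
    by_cases h1 : (∀ x ∈ ends e, x ∈ X) ∨ ends e = s(z, z)
    · rw [contract, if_pos h1, Sym2.eq_iff] at heq
      exact absurd (hq'.trans (by tauto)) (collapse_ne h₀₁ hx₁ q')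
    · rw [contract, if_neg h1] at heq
      rw [not_or] at h1
      have heT := hatt e he h1.1
      have heH := hH e he h1.1 h1.2
      obtain ⟨a, b, hab, rfl, rfl⟩ : ∃ a b, ends e = s(a, b) ∧ collapse X x₀ a = c ∧
          collapse X x₀ b = q := by
        generalize ends e = t at heq
        induction t with
        | _ a b =>
          rw [Sym2.map_mk, Sym2.eq_iff] at heq
          obtain ⟨h, h'⟩ | ⟨h, h'⟩ := heq
          · exact ⟨a, b, rfl, h, h'⟩
          · exact ⟨b, a, Sym2.eq_swap, h', h⟩
      have haT := heT a (by simp [hab])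
      have hbT := heT b (by simp [hab])
      exact ((ih a haT rfl).trans (Reaches.of_edge heH hab)).trans
        (hfib b q' hbT hq'T hq'.symm)

/-- Walks project to a contraction. -/
theorem Reaches.contract {H₁ H : Set E}
    (hH : ∀ e ∈ H, (∀ x ∈ ends e, x ∈ X) ∨ e ∈ H₁) {p q : V} (h : Reaches ends H p q) :
    Reaches (contract ends X x₀ x₁ z) H₁ (collapse X x₀ p) (collapse X x₀ q) := by
  refine h.lift _ fun p q e he heq => ?_
  by_cases h1 : ∀ x ∈ ends e, x ∈ X
  · rw [collapse_of_mem (h1 p (by simp [heq])), collapse_of_mem (h1 q (by simp [heq]))]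
    exact Relation.ReflTransGen.refl
  · by_cases h2 : ends e = s(z, z)
    · obtain rfl : p = q := by
        rw [heq, Sym2.eq_iff] at h2
        obtain ⟨rfl, rfl⟩ | ⟨rfl, rfl⟩ := h2 <;> rfl
      exact Relation.ReflTransGen.refl
    · refine Reaches.of_edge ((hH e he).resolve_left h1) ?_
      rw [contract_of_not h1 h2, heq, Sym2.map_mk]

end Contract

/-! ### Gluing packings -/

/-- A packing of the contraction of `X` cannot be completed by subgraphs inside `X` which join
all terminals and all attachments in `X`. -/
theorem ExtCex.not_glue [Finite E] {Q k : ℕ} {ends : E → Sym2 V} {S R : Set V} {v : V}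
    {P : Fin k → Set E} (h : ExtCex Q k ends S R v P) {X : Set V} {x₀ x₁ : V} (hx₀ : x₀ ∈ X)
    (hx₁ : x₁ ∈ X) (h₀₁ : x₀ ≠ x₁) (hvX : v ∉ X) {H₁ K : Fin k → Set E} {T : Fin k → Set V}
    (hdisj : PairwiseEdgeDisjoint H₁)
    (hconn : ∀ i, ConnectsSet (contract ends X x₀ x₁ v) (H₁ i) (collapse X x₀ '' S))
    (hbal : BalanceSet (contract ends X x₀ x₁ v) H₁ (collapse X x₀ '' S ∪ R \ X))
    (hext : Extend (contract ends X x₀ x₁ v) v P H₁)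
    (hKdisj : PairwiseEdgeDisjoint K) (hKX : ∀ i, ∀ e ∈ K i, ∀ x ∈ ends e, x ∈ X)
    (hT : ∀ i, ∀ t ∈ T i, ∀ t' ∈ T i, Reaches ends (K i) t t')
    (hatt : ∀ i, ∀ e ∈ H₁ i, (¬ ∀ x ∈ ends e, x ∈ X) → ∀ x ∈ ends e, x ∈ X → x ∈ T i)
    (hST : ∀ i, ∀ s ∈ S, s ∈ X → s ∈ T i)
    (hbalX : ∀ r ∈ X, r ∈ S ∪ R →
      BalanceVertex ends (fun i => {e ∈ H₁ i | ¬ ∀ x ∈ ends e, x ∈ X} ∪ K i) r) : False := by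
  obtain ⟨-, hk, -, -, -, -, -, hloop, -, hP, -, hno⟩ := h
  have hloop' : ∀ e, ends e ≠ s(v, v) := fun e he =>
    hloop e (by simp [he]) (by rw [he]; rfl)
  refine hno ⟨fun i => {e ∈ H₁ i | ¬ ∀ x ∈ ends e, x ∈ X} ∪ K i, ?_, fun i a ha b hb => ?_,
    fun r hr => ?_, fun i => ⟨?_, ?_⟩⟩
  · intro i j hij
    rw [Set.disjoint_left]
    rintro e (he | he) (he' | he')
    · exact Set.disjoint_left.1 (hdisj i j hij) he.1 he'.1
    · exact he.2 (hKX j e he')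
    · exact he'.2 (hKX i e he)
    · exact Set.disjoint_left.1 (hKdisj i j hij) he he'
  · have hab : Reaches (contract ends X x₀ x₁ v) (H₁ i) (collapse X x₀ a) (collapse X x₀ b) :=
      hconn i _ ⟨a, ha, rfl⟩ _ ⟨b, hb, rfl⟩
    exact hab.of_contract (H := {e ∈ H₁ i | ¬ ∀ x ∈ ends e, x ∈ X} ∪ K i) hx₀ hx₁ h₀₁
      (fun t ht t' ht' => (hT i t ht t' ht').mono Set.subset_union_right) (hatt i)
      (fun e he h1 _ => Or.inl ⟨he, h1⟩) (hST i a ha) rfl b (hST i b hb) rfl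
  · by_cases hrX : r ∈ X
    · exact hbalX r hrX hr
    · have hr' : r ∈ collapse X x₀ '' S ∪ R \ X :=
        hr.imp (fun h => ⟨r, h, collapse_of_notMem hrX⟩) (fun h => ⟨h, hrX⟩)
      refine (hbal r hr').mono hk (incEdges_contract_subset hx₀ hx₁ hrX) fun i => ?_
      rw [incEdges_contract hx₀ hx₁ hrX fun e _ => hloop' e]
      rintro e ⟨h1, h2 | h2⟩
      · exact ⟨h1, h2.1⟩
      · exact absurd (hKX i e h2 r h1) hrX
  · intro e he
    exact Or.inl ⟨(hext i).1 he, fun h => hvX (h v (hP.1.1 i he))⟩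
  · rintro ⟨a, b, hav, hbv, hab, hnab⟩
    have hfv : ∀ {x}, x ≠ v → collapse X x₀ x ≠ v := fun hx h =>
      hx ((collapse_eq_iff_of_notMem hx₀ hvX).1 h)
    have hesc : ∀ {a b}, Reaches ends ({e ∈ H₁ i | ¬ ∀ x ∈ ends e, x ∈ X} ∪ K i) a b →
        Reaches ends (K i) a b ∨ ∃ a', (a' ∈ X → a' ∈ T i) ∧
          collapse X x₀ a' = collapse X x₀ a ∧ Reaches ends (K i) a a' := by
      intro a b hab
      by_cases haX : a ∉ X
      · exact Or.inr ⟨a, fun h => absurd h haX, rfl, Relation.ReflTransGen.refl⟩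
      rw [not_not] at haX
      suffices hs : (b ∈ X ∧ Reaches ends (K i) a b) ∨ ∃ a' ∈ X, a' ∈ T i ∧
          Reaches ends (K i) a a' by
        refine hs.imp And.right ?_
        rintro ⟨a', h1, h2, h3⟩
        exact ⟨a', fun _ => h2, by rw [collapse_of_mem h1, collapse_of_mem haX], h3⟩
      induction hab with
      | refl => exact Or.inl ⟨haX, Relation.ReflTransGen.refl⟩
      | @tail c d _ hcd ih =>
        obtain ⟨hcX, hc⟩ | hc := ih
        · obtain ⟨e, he | he, heq⟩ := hcd
          · exact Or.inr ⟨c, hcX, hatt i e he.1 he.2 c (by simp [heq]) hcX, hc⟩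
          · exact Or.inl ⟨hKX i e he d (by simp [heq]), hc.trans (Reaches.of_edge he heq)⟩
        · exact Or.inr hc
    have hKH : K i ⊆ {e ∈ {e ∈ H₁ i | ¬ ∀ x ∈ ends e, x ∈ X} ∪ K i | v ∉ ends e} :=
      fun e he => ⟨Or.inr he, fun h => hvX (hKX i e he v h)⟩
    obtain h1 | ⟨a', ha'T, ha', haa'⟩ := hesc hab
    · exact hnab (h1.mono hKH)
    obtain h1 | ⟨b', hb'T, hb', hbb'⟩ := hesc hab.symm
    · exact hnab (h1.symm.mono hKH)
    have h2 : Reaches (contract ends X x₀ x₁ v) {e ∈ H₁ i | v ∉ contract ends X x₀ x₁ v e}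
        (collapse X x₀ a) (collapse X x₀ b) := by
      by_contra hcon
      refine (hext i).2 ⟨_, _, hfv hav, hfv hbv, hab.contract ?_, hcon⟩
      rintro e (he | he)
      · exact Or.inr he.1
      · exact Or.inl (hKX i e he)
    have h3 := h2.of_contract hx₀ hx₁ h₀₁
      (H := {e ∈ {e ∈ H₁ i | ¬ ∀ x ∈ ends e, x ∈ X} ∪ K i | v ∉ ends e})
      (fun t ht t' ht' => (hT i t ht t' ht').mono hKH) (fun e he => hatt i e he.1)
      (fun e he h4 h5 => ⟨Or.inl ⟨he.1, h4⟩, fun h => he.2 (mem_contract_of_mem hvX h5 h)⟩)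
      ha'T ha' b' hb'T hb'
    exact hnab (((haa'.mono hKH).trans h3).trans (hbb'.symm.mono hKH))

theorem MinExtCex.exists_packing [Finite V] [Finite E] {Q k : ℕ} {ends : E → Sym2 V}
    {S R : Set V} {v : V} {P : Fin k → Set E} (h : MinExtCex Q k ends S R v P)
    {ends' : E → Sym2 V} {S' R' : Set V} {v' : V} {P' : Fin k → Set E}
    (hlt : {e | ¬ (ends' e).IsDiag}.ncard < {e | ¬ (ends e).IsDiag}.ncard)
    (hSR : Disjoint S' R') (hS : ∃ t ∈ S', t ≠ v')
    (hconn : ∀ X : Set V, (∃ a ∈ S', a ∈ X) → (∃ b ∈ S', b ∉ X) → Q * k ≤ (cut ends' X).ncard)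
    (hR : ∀ r ∈ R', (Q - 2) * k ≤ deg ends' r) (hv : v' ∈ S')
    (hloop : ∀ e, v' ∈ ends' e → ¬ (ends' e).IsDiag) (hdeg : deg ends' v' = Q * k)
    (hP : IsBalancedSubpartitionAt ends' v' P') (hP2 : ∀ i, 2 ≤ (P' i).ncard) :
    ∃ H : Fin k → Set E, PairwiseEdgeDisjoint H ∧ (∀ i, ConnectsSet ends' (H i) S') ∧
      BalanceSet ends' H (S' ∪ R') ∧ Extend ends' v' P' H := by
  by_contra hno
  refine absurd (h.2 V E ‹_› ‹_› ends' S' R' v' P' ⟨h.1.1, h.1.2.1, hSR, ?_,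
    edgeConnectedIn_univ_iff.2 hconn, hR, hv, hloop, hdeg, hP, hP2, hno⟩) ?_
  · obtain ⟨t, ht, htv⟩ := hS
    rw [← Set.ncard_pair htv]
    exact Set.ncard_le_ncard (by rintro x (rfl | rfl) <;> assumption) (Set.toFinite _)
  · rw [not_le]
    exact Nat.add_lt_add_left hlt _

theorem MinExtCex.exists_packing_contract [Finite V] [Finite E] {Q k : ℕ} {ends : E → Sym2 V}
    {S R : Set V} {v : V} {P : Fin k → Set E} (h : MinExtCex Q k ends S R v P)
    {X : Set V} {x₀ x₁ z : V} (hx₀ : x₀ ∈ X) (hx₁ : x₁ ∈ X) (h₀₁ : x₀ ≠ x₁)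
    {e₀ : E} (he₀ : ∀ x ∈ ends e₀, x ∈ X) (hd : ¬ (ends e₀).IsDiag)
    (hz : z ∈ collapse X x₀ '' S) (hzx : z = x₀ ∨ z ∉ X)
    (hS : ∃ t ∈ S, collapse X x₀ t ≠ z)
    (hcut : (cut ends (collapse X x₀ ⁻¹' {z})).ncard = Q * k)
    {P' : Fin k → Set E} (hP : IsBalancedSubpartitionAt (contract ends X x₀ x₁ z) z P')
    (hP2 : ∀ i, 2 ≤ (P' i).ncard) :
    ∃ H : Fin k → Set E, PairwiseEdgeDisjoint H ∧
      (∀ i, ConnectsSet (contract ends X x₀ x₁ z) (H i) (collapse X x₀ '' S)) ∧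
      BalanceSet (contract ends X x₀ x₁ z) H (collapse X x₀ '' S ∪ R \ X) ∧
      Extend (contract ends X x₀ x₁ z) z P' H := by
  have hzx' : z = x₀ ∨ z = z ∧ z ∉ X := hzx.imp_right fun h => ⟨rfl, h⟩
  obtain ⟨-, -, hSR, -, hconn, hR, -⟩ := h.1
  have hdisj : Disjoint (collapse X x₀ '' S) (R \ X) := by
    rw [Set.disjoint_left]
    rintro _ ⟨s, hs, rfl⟩ ⟨h1, h2⟩
    by_cases hsX : s ∈ X
    · rw [collapse_of_mem hsX] at h2
      exact h2 hx₀
    · rw [collapse_of_notMem hsX] at h1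
      exact Set.disjoint_left.1 hSR hs h1
  refine h.exists_packing (ncard_nonloop_contract_lt he₀ hd) hdisj ?_ ?_ ?_ hz ?_ ?_ hP hP2
  · obtain ⟨t, ht, htz⟩ := hS
    exact ⟨_, ⟨t, ht, rfl⟩, htz⟩
  · rintro Y ⟨_, ⟨a, ha, rfl⟩, haY⟩ ⟨_, ⟨b, hb, rfl⟩, hbY⟩
    rw [cut_contract]
    exact edgeConnectedIn_univ_iff.1 hconn _ ⟨a, ha, haY⟩ ⟨b, hb, hbY⟩
  · intro r hr
    refine (hR r hr.1).trans_eq ?_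
    rw [deg, deg, incEdges_contract hx₀ hx₁ hr.2]
    intro e her hez
    rw [hez, Sym2.mem_iff, or_self] at her
    exact Set.disjoint_left.1 hdisj hz (her ▸ hr)
  · intro e he hdiag
    obtain ⟨y, hy⟩ := Sym2.mem_iff_exists.1 he
    rw [hy, Sym2.mk_isDiag_iff] at hdiag
    subst hdiag
    exact contract_ne_loop hx₀ hx₁ h₀₁ hzx' e hy
  · rw [deg, incEdges_contract_eq_cut hx₀ hx₁ h₀₁ hzx', hcut]

theorem IsBalancedSubpartitionAt.congr {k : ℕ} {ends ends' : E → Sym2 V} {x x' : V}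
    {P : Fin k → Set E} (h : IsBalancedSubpartitionAt ends x P)
    (hinc : incEdges ends' x' = incEdges ends x) : IsBalancedSubpartitionAt ends' x' P := by
  simpa only [IsBalancedSubpartitionAt, IsBalancedPartitionAt, IsSubpartitionAt, hinc] using h

theorem exists_mem_ne_of_not_isDiag {t : Sym2 V} (h : ¬ t.IsDiag) (x₀ : V) :
    ∃ x ∈ t, x₀ ≠ x := by
  induction t with
  | _ p q =>
    rw [Sym2.mk_isDiag_iff] at h
    by_cases hp : x₀ = p
    · exact ⟨q, by simp, hp ▸ h⟩
    · exact ⟨p, by simp, hp⟩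

theorem contract_eq_self {ends : E → Sym2 V} {X : Set V} {x₀ x₁ z : V} {e : E}
    (h : ¬ ∀ x ∈ ends e, x ∈ X) (h' : ends e ≠ s(z, z)) (hfix : ∀ x ∈ ends e, x ∈ X → x = x₀) :
    contract ends X x₀ x₁ z e = ends e := by
  rw [contract_of_not h h']
  have hfix' : ∀ x ∈ ends e, collapse X x₀ x = x := fun x hx => by
    by_cases hxX : x ∈ X
    · rw [collapse_of_mem hxX, hfix x hx hxX]
    · exact collapse_of_notMem hxX
  generalize ends e = t at hfix'
  induction t with
  | _ p q => rw [Sym2.map_mk, hfix' p (by simp), hfix' q (by simp)]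

theorem eq_of_contract_eq {ends : E → Sym2 V} {X : Set V} {x₀ x₁ z p q : V} {e : E}
    (h : (∀ x ∈ ends e, x ∈ X) ∨ ends e = s(z, z))
    (heq : contract ends X x₀ x₁ z e = s(p, q)) : p = q := by
  rw [contract, if_pos h, Sym2.eq_iff] at heq
  obtain ⟨rfl, rfl⟩ | ⟨rfl, rfl⟩ := heq <;> rfl

/-! ### Minimal counterexamples -/

section Minimal

variable {Q k : ℕ} {ends : E → Sym2 V} {S R : Set V} {v : V} {P : Fin k → Set E}

theorem ExtCex.ne_loop (h : ExtCex Q k ends S R v P) (e : E) : ends e ≠ s(v, v) := fun he =>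
  h.2.2.2.2.2.2.2.1 e (by simp [he]) (by rw [he]; rfl)

theorem ExtCex.exists_mem_ne (h : ExtCex Q k ends S R v P) : ∃ t ∈ S, t ≠ v :=
  Set.exists_ne_of_one_lt_ncard h.2.2.2.1 v

variable [Finite V] [Finite E]

theorem ExtCex.le_ncard_cut (h : ExtCex Q k ends S R v P) {X : Set V} (ha : ∃ a ∈ S, a ∈ X)
    (hb : ∃ b ∈ S, b ∉ X) : Q * k ≤ (cut ends X).ncard :=
  edgeConnectedIn_univ_iff.1 h.2.2.2.2.1 X ha hb

theorem MinExtCex.exists_packing_contract_base (h : MinExtCex Q k ends S R v P) {X : Set V}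
    {x₀ x₁ : V} (hx₀ : x₀ ∈ X) (hx₁ : x₁ ∈ X) (h₀₁ : x₀ ≠ x₁) (hvX : v ∉ X)
    {e₀ : E} (he₀ : ∀ x ∈ ends e₀, x ∈ X) (hd : ¬ (ends e₀).IsDiag) :
    ∃ H : Fin k → Set E, PairwiseEdgeDisjoint H ∧
      (∀ i, ConnectsSet (contract ends X x₀ x₁ v) (H i) (collapse X x₀ '' S)) ∧
      BalanceSet (contract ends X x₀ x₁ v) H (collapse X x₀ '' S ∪ R \ X) ∧
      Extend (contract ends X x₀ x₁ v) v P H := by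
  have hne := h.1.ne_loop
  obtain ⟨t, ht, htv⟩ := h.1.exists_mem_ne
  obtain ⟨-, -, -, -, -, -, hv, -, hdeg, hP, hP2, -⟩ := h.1
  refine h.exists_packing_contract hx₀ hx₁ h₀₁ he₀ hd ⟨v, hv, collapse_of_notMem hvX⟩
    (Or.inr hvX) ⟨t, ht, fun h => htv ((collapse_eq_iff_of_notMem hx₀ hvX).1 h)⟩ ?_
    (hP.congr (incEdges_contract hx₀ hx₁ hvX fun e _ => hne e)) hP2
  rw [preimage_collapse_of_notMem hx₀ hvX, ← incEdges_eq_cut fun e _ => hne e]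
  exact hdeg

/-- A minimal counterexample has no nontrivial tight cut. -/
theorem MinExtCex.not_tight (h : MinExtCex Q k ends S R v P) {X : Set V} (hvX : v ∉ X) {s : V}
    (hs : s ∈ S) (hsX : s ∈ X) (hcut : (cut ends X).ncard = Q * k) {e₁ e₂ : E}
    (he₁ : ∀ x ∈ ends e₁, x ∈ X) (hd₁ : ¬ (ends e₁).IsDiag)
    (he₂ : ∀ x ∈ ends e₂, x ∈ Xᶜ) (hd₂ : ¬ (ends e₂).IsDiag) : False := by
  have hne := h.1.ne_loop
  have hv : v ∈ S := h.1.2.2.2.2.2.2.1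
  have hk := h.1.2.1
  obtain ⟨x₁, hx₁e, hsx₁⟩ := exists_mem_ne_of_not_isDiag hd₁ s
  obtain ⟨y₁, hy₁e, hvy₁⟩ := exists_mem_ne_of_not_isDiag hd₂ v
  have hx₁ := he₁ x₁ hx₁e
  have hy₁ := he₂ y₁ hy₁e
  have hvX' : v ∈ Xᶜ := hvX
  obtain ⟨H₁, hdisj₁, hconn₁, hbal₁, hext₁⟩ :=
    h.exists_packing_contract_base hsX hx₁ hsx₁ hvX he₁ hd₁
  have hinc₁ : incEdges (contract ends X s x₁ v) s = cut ends X := by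
    rw [incEdges_contract_eq_cut hsX hx₁ hsx₁ (Or.inl rfl), preimage_collapse_self hsX]
  have hinc₂ : incEdges (contract ends Xᶜ v y₁ v) v = cut ends X := by
    rw [incEdges_contract_eq_cut hvX' hy₁ hvy₁ (Or.inl rfl), preimage_collapse_self hvX',
      cut_compl]
  obtain ⟨-, P', hP', hH₁P'⟩ := hbal₁ s (Or.inl ⟨s, hs, collapse_of_mem hsX⟩)
  rw [hinc₁] at hH₁P'
  obtain ⟨H₂, hdisj₂, hconn₂, hbal₂, hext₂⟩ := h.exists_packing_contract (P' := P') hvX' hy₁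
    hvy₁ he₂ hd₂ ⟨v, hv, collapse_of_mem hvX'⟩ (Or.inl rfl)
    ⟨s, hs, by rw [collapse_of_notMem (not_not.2 hsX)]; rintro rfl; exact hvX hsX⟩
    (by rw [preimage_collapse_self hvX', cut_compl, hcut])
    (hP'.isBalancedSubpartitionAt.congr (hinc₂.trans hinc₁.symm)) hP'.2.2
  have hcross : ∀ i, ∀ e ∈ H₁ i, (¬ ∀ x ∈ ends e, x ∈ X) → ∀ t ∈ ends e, t ∈ X →
      e ∈ H₂ i := by
    intro i e he hin t hte htX
    push Not at hin
    exact (hext₂ i).1 (hH₁P' i ⟨⟨⟨t, hte, htX⟩, hin⟩, he⟩)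
  have hreach : ∀ i t, t ∈ X → (t ∈ S ∨ ∃ e ∈ H₁ i, (¬ ∀ x ∈ ends e, x ∈ X) ∧ t ∈ ends e) →
      Reaches (contract ends Xᶜ v y₁ v) (H₂ i) t v := by
    rintro i t htX (htS | ⟨e, he, hin, hte⟩)
    · exact hconn₂ i t ⟨t, htS, collapse_of_notMem (not_not.2 htX)⟩ v
        ⟨v, hv, collapse_of_mem hvX'⟩
    · have he₂ := hcross i e he hin t hte htX
      push Not at hin
      obtain ⟨y, hye, hyX⟩ := hin
      have hty : t ≠ y := by rintro rfl; exact hyX htX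
      have heq := (Sym2.mem_and_mem_iff hty).1 ⟨hte, hye⟩
      refine Reaches.of_edge he₂ ?_
      rw [contract_of_not (X := Xᶜ) (fun h => h t hte htX) (hne e), heq, Sym2.map_mk,
        collapse_of_notMem (not_not.2 htX), collapse_of_mem (X := Xᶜ) hyX]
  refine h.1.not_glue hsX hx₁ hsx₁ hvX (K := fun i => {e ∈ H₂ i | ∀ x ∈ ends e, x ∈ X})
    (T := fun i => {t | t ∈ X ∧ (t ∈ S ∨ ∃ e ∈ H₁ i, (¬ ∀ x ∈ ends e, x ∈ X) ∧ t ∈ ends e)})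
    hdisj₁ hconn₁ hbal₁ hext₁
    (fun i j hij => (hdisj₂ i j hij).mono (fun _ h => h.1) (fun _ h => h.1))
    (fun i e he => he.2) ?_ (fun i e he hin x hx hxX => ⟨hxX, Or.inr ⟨e, he, hin, hx⟩⟩)
    (fun i t ht htX => ⟨htX, Or.inl ht⟩) ?_
  · rintro i t ⟨htX, ht⟩ t' ⟨htX', ht'⟩
    have h1 := (hreach i t htX ht).trans (hreach i t' htX' ht').symm
    have h2 : Reaches (contract ends Xᶜ v y₁ v)
        {e ∈ H₂ i | v ∉ contract ends Xᶜ v y₁ v e} t t' := by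
      by_contra hcon
      exact (hext₂ i).2 ⟨t, t', fun h => hvX (h ▸ htX), fun h => hvX (h ▸ htX'), h1, hcon⟩
    refine h2.lift id fun p q e he heq => ?_
    by_cases hm : (∀ x ∈ ends e, x ∈ Xᶜ) ∨ ends e = s(v, v)
    · obtain rfl := eq_of_contract_eq hm heq
      exact Relation.ReflTransGen.refl
    · rw [not_or] at hm
      have hX : ∀ x ∈ ends e, x ∈ X := fun x hx => by
        by_contra hxX
        refine he.2 ?_
        rw [contract_of_not hm.1 hm.2]
        exact Sym2.mem_map.2 ⟨x, hx, collapse_of_mem hxX⟩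
      rw [contract_eq_self hm.1 hm.2 fun x hx hxX => absurd (hX x hx) hxX] at heq
      exact Reaches.of_edge ⟨he.1, hX⟩ heq
  · intro r hrX hr
    have hrX' : r ∉ Xᶜ := not_not.2 hrX
    have hr' : r ∈ collapse Xᶜ v '' S ∪ R \ Xᶜ :=
      hr.imp (fun h => ⟨r, h, collapse_of_notMem hrX'⟩) (fun h => ⟨h, hrX'⟩)
    refine (hbal₂ r hr').mono hk (incEdges_contract_subset hvX' hy₁ hrX') fun i => ?_
    rw [incEdges_contract hvX' hy₁ hrX' fun e _ => hne e]
    rintro e ⟨h1, h2 | h2⟩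
    · exact ⟨h1, hcross i e h2.1 h2.2 r h1 hrX⟩
    · exact ⟨h1, h2.1⟩

/-- In a minimal counterexample, every edge `uw` with `u ∉ S ∪ R` and `w ≠ v` lies in a
tight cut. -/
theorem MinExtCex.exists_tight (h : MinExtCex Q k ends S R v P) {u w : V} {e : E}
    (he : ends e = s(u, w)) (huw : u ≠ w) (huS : u ∉ S) (huR : u ∉ R) (hwv : w ≠ v) :
    ∃ X : Set V, v ∉ X ∧ (∃ s ∈ S, s ∈ X) ∧ (cut ends X).ncard = Q * k ∧ e ∈ cut ends X := by
  classical
  by_contra! hcon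
  have hc := h.1
  obtain ⟨-, hk, hSR, -, -, hR, hv, hloop, hdeg, hP, hP2, hno⟩ := h.1
  have huv : u ≠ v := fun h => huS (h ▸ hv)
  set ends' : E → Sym2 V := Function.update ends e s(w, w) with hends'
  have he' : ends' e = s(w, w) := Function.update_self ..
  have hoff : ∀ e', e' ≠ e → ends' e' = ends e' := fun e' h => Function.update_of_ne h ..
  have hinc : ∀ r, r ≠ u → incEdges ends' r = incEdges ends r := by
    intro r hru
    ext e'
    by_cases hee : e' = e
    · subst hee
      simp [incEdges, he, he', hru]
    · simp [incEdges, hoff e' hee]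
  have hcut : ∀ X, cut ends X \ {e} ⊆ cut ends' X := by
    rintro X e' ⟨h1, h2⟩
    simpa only [cut, Set.mem_ofPred_eq, hoff e' h2] using h1
  refine absurd (h.exists_packing (ends' := ends') (S' := S) (R' := R) (v' := v) (P' := P)
    ?_ hSR hc.exists_mem_ne ?_ ?_ hv ?_ ?_ (hP.congr (hinc v huv.symm)) hP2) ?_
  · refine Set.ncard_lt_ncard ⟨fun e' h1 => ?_, fun hsub => ?_⟩ (Set.toFinite _)
    · by_cases hee : e' = e
      · subst hee
        exact absurd (by rw [he']; rfl) h1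
      · simpa only [Set.mem_ofPred_eq, hoff e' hee] using h1
    · have : e ∈ {e | ¬ (ends e).IsDiag} := by
        simpa only [Set.mem_ofPred_eq, he, Sym2.mk_isDiag_iff] using huw
      exact hsub this (by rw [he']; rfl)
  · intro X ha hb
    have hle := hc.le_ncard_cut ha hb
    by_cases heX : e ∈ cut ends X
    · have hne : (cut ends X).ncard ≠ Q * k := by
        intro hcard
        by_cases hvX : v ∈ X
        · exact hcon Xᶜ (not_not.2 hvX) hb (by rwa [cut_compl]) (by rwa [cut_compl])
        · exact hcon X hvX ha hcard heX
      have := Set.ncard_le_ncard (hcut X) (Set.toFinite _)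
      have := Set.ncard_sdiff_singleton_add_one heX (Set.toFinite _)
      omega
    · refine hle.trans (Set.ncard_le_ncard ?_ (Set.toFinite _))
      exact (Set.sdiff_singleton_eq_self heX).symm.subset.trans (hcut X)
  · intro r hr
    rw [deg, hinc r (by rintro rfl; exact huR hr)]
    exact hR r hr
  · intro e' hve'
    have hee : e' ≠ e := by
      rintro rfl
      rw [he', Sym2.mem_iff, or_self] at hve'
      exact hwv hve'.symm
    rw [hoff e' hee] at hve' ⊢
    exact hloop e' hve'
  · rw [deg, hinc v huv.symm]
    exact hdeg
  · rintro ⟨H, h1, h2, h3, h4⟩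
    refine hno ⟨fun i => H i \ {e},
      fun i j hij => (h1 i j hij).mono Set.sdiff_subset Set.sdiff_subset, ?_, ?_, fun i => ⟨?_, ?_⟩⟩
    · intro i a ha b hb
      have hab : Reaches ends' (H i) a b := h2 i a ha b hb
      refine hab.lift id fun p q e' he'H heq => ?_
      by_cases hee : e' = e
      · subst hee
        rw [he', Sym2.eq_iff] at heq
        obtain ⟨rfl, rfl⟩ | ⟨rfl, rfl⟩ := heq <;> exact Relation.ReflTransGen.refl
      · exact Reaches.of_edge ⟨he'H, hee⟩ (hoff e' hee ▸ heq)
    · intro r hr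
      have hru : r ≠ u := by
        rintro rfl
        exact hr.elim huS huR
      refine (h3 r hr).mono hk (hinc r hru).subset fun i => ?_
      rw [hinc r hru]
      exact Set.inter_subset_inter_right _ Set.sdiff_subset
    · refine Set.subset_sdiff_singleton (h4 i).1 fun heP => ?_
      have := hP.1.1 i heP
      simp only [incEdges, he, Set.mem_ofPred_eq, Sym2.mem_iff] at this
      exact this.elim (fun h => huv h.symm) (fun h => hwv h.symm)
    · rintro ⟨a, b, hav, hbv, hab, hnab⟩
      refine (h4 i).2 ⟨a, b, hav, hbv, ?_, fun hr => hnab ?_⟩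
      · exact hab.lift id fun p q e' he'H heq =>
          Reaches.of_edge he'H.1 ((hoff e' he'H.2).trans heq)
      · refine hr.lift id fun p q e' he'H heq => ?_
        by_cases hee : e' = e
        · subst hee
          rw [he', Sym2.eq_iff] at heq
          obtain ⟨rfl, rfl⟩ | ⟨rfl, rfl⟩ := heq <;> exact Relation.ReflTransGen.refl
        · rw [hoff e' hee] at heq
          exact Reaches.of_edge ⟨⟨he'H.1, hee⟩, by simpa only [hoff e' hee] using he'H.2⟩ heq

/-- In a minimal counterexample, every neighbor other than `v` of a vertex outside `S ∪ R` is a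
terminal incident to exactly `Q * k` edges that are not self-loops. -/
theorem MinExtCex.neighbor (h : MinExtCex Q k ends S R v P) {u w : V} {e : E}
    (he : ends e = s(u, w)) (huw : u ≠ w) (huS : u ∉ S) (huR : u ∉ R) (hwv : w ≠ v) :
    w ∈ S ∧ (cut ends {w}).ncard = Q * k := by
  obtain ⟨X, hvX, ⟨s, hs, hsX⟩, hcard, heX⟩ := h.exists_tight he huw huS huR hwv
  have hv : v ∈ S := h.1.2.2.2.2.2.2.1
  have hloop := h.1.2.2.2.2.2.2.2.1
  have hdeg := h.1.2.2.2.2.2.2.2.2.1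
  have huv : u ≠ v := fun h => huS (h ▸ hv)
  obtain ⟨e₂, hve₂, he₂⟩ : ∃ e₂, v ∈ ends e₂ ∧ ∀ x ∈ ends e₂, x ∈ Xᶜ := by
    by_contra! hcon
    have hsub : incEdges ends v ⊆ cut ends X := fun e' he' => by
      obtain ⟨x, hx, hxX⟩ := hcon e' he'
      exact ⟨⟨x, hx, not_not.1 hxX⟩, v, he', hvX⟩
    have heq := Set.eq_of_subset_of_ncard_le hsub (hcard.trans hdeg.symm).le (Set.toFinite _)
    rw [← heq] at heX
    simp only [incEdges, he, Set.mem_ofPred_eq, Sym2.mem_iff] at heX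
    exact heX.elim (fun h => huv h.symm) (fun h => hwv h.symm)
  have hsv : s ≠ v := fun h => hvX (h ▸ hsX)
  have hsub : cut ends {s} ⊆ cut ends X := by
    rintro e' ⟨⟨x, hx, rfl⟩, y, hy, hyx⟩
    refine ⟨⟨x, hx, hsX⟩, ?_⟩
    by_contra! hin
    refine h.not_tight hvX hs hsX hcard (e₁ := e') hin ?_ he₂ (hloop e₂ hve₂)
    have hxy : x ≠ y := fun h => hyx h.symm
    rwa [(Sym2.mem_and_mem_iff hxy).1 ⟨hx, hy⟩, Sym2.mk_isDiag_iff]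
  have hle : Q * k ≤ (cut ends {s}).ncard :=
    h.1.le_ncard_cut ⟨s, hs, rfl⟩ ⟨v, hv, fun h => hsv h.symm⟩
  have heq := Set.eq_of_subset_of_ncard_le hsub (hcard.le.trans hle) (Set.toFinite _)
  rw [← heq] at heX hcard
  obtain ⟨⟨x, hx, rfl⟩, -⟩ := heX
  rw [he, Sym2.mem_iff] at hx
  obtain rfl | rfl := hx
  · exact absurd hs huS
  · exact ⟨hs, hcard⟩

/-- In a minimal counterexample, no vertex set `B ∌ v` is separated from the remaining vertices
by a neighbor `u ∉ S ∪ R`. -/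
theorem MinExtCex.not_separated (h : MinExtCex Q k ends S R v P) {B : Set V} {u w : V} {e : E}
    (huS : u ∉ S) (huR : u ∉ R) (hvB : v ∉ B) (huB : u ∉ B) (hwB : w ∈ B)
    (he : ends e = s(u, w)) (hB : ∀ e, ∀ x ∈ ends e, x ∈ B → ∀ y ∈ ends e, y ∈ insert u B) :
    False := by
  have hv : v ∈ S := h.1.2.2.2.2.2.2.1
  have huv : u ≠ v := fun h => huS (h ▸ hv)
  have huw : u ≠ w := fun h => huB (h ▸ hwB)
  have hwv : w ≠ v := fun h => hvB (h ▸ hwB)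
  have hQ := h.1.1
  have hk := h.1.2.1
  have hQk : 2 * k ≤ Q * k := Nat.mul_le_mul_right k (by omega)
  have hvX : v ∉ insert u B := by
    rintro (h | h)
    · exact huv h.symm
    · exact hvB h
  have huX : u ∈ insert u B := Set.mem_insert u B
  have hwX : w ∈ insert u B := Or.inr hwB
  obtain ⟨H₁, hdisj₁, hconn₁, hbal₁, hext₁⟩ :=
    h.exists_packing_contract_base (e₀ := e) huX hwX huw hvX
      (fun x hx => hB e w (by simp [he]) hwB x hx) (by rwa [he, Sym2.mk_isDiag_iff])
  have glue : ∀ K : Fin k → Set E, PairwiseEdgeDisjoint K →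
      (∀ i, ∀ e ∈ K i, ∃ x ∈ ends e, x ∈ B) →
      (∀ i, ∀ s ∈ S, s ∈ B → Reaches ends (K i) s u) →
      (∀ r ∈ B, r ∈ S ∪ R → BalanceVertex ends K r) → False := by
    intro K hK hKB hreach hbal
    have hreach' : ∀ i t, t = u ∨ t ∈ S ∧ t ∈ B → Reaches ends (K i) t u := by
      rintro i t (rfl | ⟨h1, h2⟩)
      · exact Relation.ReflTransGen.refl
      · exact hreach i t h1 h2
    refine h.1.not_glue huX hwX huw hvX (K := K) (T := fun i => {t | t = u ∨ t ∈ S ∧ t ∈ B})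
      hdisj₁ hconn₁ hbal₁ hext₁ hK ?_
      (fun i t ht t' ht' => (hreach' i t ht).trans (hreach' i t' ht').symm) ?_ ?_ ?_
    · intro i e he x hx
      obtain ⟨y, hy, hyB⟩ := hKB i e he
      exact hB e y hy hyB x hx
    · rintro i e - hin x hx (hxu | hxB)
      · exact Or.inl hxu
      · exact absurd (hB e x hx hxB) hin
    · rintro i s hs (rfl | hsB)
      · exact absurd hs huS
      · exact Or.inr ⟨hs, hsB⟩
    · rintro r (rfl | hrB) hr
      · exact (hr.elim huS huR).elim
      · refine (hbal r hrB hr).mono hk subset_rfl fun i => ?_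
        rintro e ⟨h1, h2 | h2⟩
        · exact absurd (hB e r h1 hrB) h2.2
        · exact ⟨h1, h2⟩
  by_cases hSB : ∃ s ∈ S, s ∈ B
  · obtain ⟨hwS, hwcut⟩ := h.neighbor he huw huS huR hwv
    have hloop := h.1.2.2.2.2.2.2.2.1
    have hdeg := h.1.2.2.2.2.2.2.2.2.1
    obtain ⟨e₀, hve₀⟩ : (incEdges ends v).Nonempty := by
      rw [Set.nonempty_iff_ne_empty]
      intro hempty
      rw [deg, hempty, Set.ncard_empty] at hdeg
      omega
    have huX' : u ∈ Bᶜ := huB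
    have hvX' : v ∈ Bᶜ := hvB
    have hwX' : w ∉ Bᶜ := not_not.2 hwB
    have hinc : incEdges (contract ends Bᶜ u v w) w = cut ends {w} := by
      rw [incEdges_contract_eq_cut huX' hvX' huv (Or.inr ⟨rfl, hwX'⟩),
        preimage_collapse_of_notMem huX' hwX']
    obtain ⟨P', hP'⟩ := exists_isBalancedPartitionAt (ends := contract ends Bᶜ u v w) (x := w) hk
      (by rw [deg, hinc, hwcut]; exact hQk)
    obtain ⟨H₂, hdisj₂, hconn₂, hbal₂, -⟩ := h.exists_packing_contract (P' := P') (e₀ := e₀)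
      huX' hvX' huv (fun x hx hxB => hvX (hB e₀ x hx hxB v hve₀)) (hloop e₀ hve₀)
      ⟨w, hwS, collapse_of_notMem hwX'⟩ (Or.inr hwX')
      ⟨v, hv, by rwa [collapse_of_mem hvX']⟩
      (by rw [preimage_collapse_of_notMem huX' hwX', hwcut])
      hP'.isBalancedSubpartitionAt hP'.2.2
    refine glue (fun i => {e ∈ H₂ i | (∃ x ∈ ends e, x ∈ B) ∧ ends e ≠ s(w, w)})
      (fun i j hij => (hdisj₂ i j hij).mono (fun _ h => h.1) (fun _ h => h.1))
      (fun i e he => he.2.1) ?_ ?_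
    · intro i s hs hsB
      have hsu : Reaches (contract ends Bᶜ u v w) (H₂ i) s u :=
        hconn₂ i s ⟨s, hs, collapse_of_notMem (not_not.2 hsB)⟩ u ⟨v, hv, collapse_of_mem hvX'⟩
      refine hsu.lift id fun p q e he heq => ?_
      by_cases hm : (∀ x ∈ ends e, x ∈ Bᶜ) ∨ ends e = s(w, w)
      · obtain rfl := eq_of_contract_eq hm heq
        exact Relation.ReflTransGen.refl
      · rw [not_or] at hm
        have hxB : ∃ x ∈ ends e, x ∈ B := by
          by_contra! hcon
          exact hm.1 hcon
        obtain ⟨x, hx, hxB'⟩ := hxB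
        rw [contract_eq_self hm.1 hm.2 fun y hy hyB =>
          (hB e x hx hxB' y hy).resolve_right hyB] at heq
        exact Reaches.of_edge ⟨he, ⟨x, hx, hxB'⟩, hm.2⟩ heq
    · intro r hrB hr
      have hrX : r ∉ Bᶜ := not_not.2 hrB
      have hr' : r ∈ collapse Bᶜ u '' S ∪ R \ Bᶜ :=
        hr.imp (fun h => ⟨r, h, collapse_of_notMem hrX⟩) (fun h => ⟨h, hrX⟩)
      refine (hbal₂ r hr').mono hk (incEdges_contract_subset huX' hvX' hrX) fun i => ?_
      rintro e ⟨h1, h2, -, h3⟩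
      exact ⟨mem_contract_of_mem hrX h3 h1, h2⟩
  · push Not at hSB
    refine glue (fun _ => ∅) (fun _ _ _ => Set.disjoint_empty _) (fun _ _ h => h.elim)
      (fun _ s hs hsB => absurd hsB (hSB s hs)) fun r hrB hr => ?_
    have hrR : r ∈ R := hr.resolve_left fun hrS => hSB r hrS hrB
    have hdeg : 2 * k ≤ deg ends r :=
      (Nat.mul_le_mul_right k (by omega)).trans (h.1.2.2.2.2.2.1 r hrR)
    obtain ⟨P', hP'⟩ := exists_isBalancedPartitionAt hk hdeg
    exact ⟨⟨fun _ => Set.inter_subset_left, fun _ _ _ => by simp⟩, P', hP', by simp⟩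

end Minimal

/-- In a minimal counterexample to the Extension Theorem,
no vertex of `V(G) − S − R` is a cut vertex of `G`. -/
theorem min_cex_no_cut_vertex {V E : Type} [Fintype V] [Fintype E]
    (Q k : ℕ) (ends : E → Sym2 V) (S R : Set V) (v : V) (P : Fin k → Set E)
    (h : MinExtCex Q k ends S R v P) :
    ∀ u : V, u ∉ S → u ∉ R → ¬ IsCutVertexOf ends Set.univ u := by
  intro u huS huR ⟨a, b, hau, hbu, hab, hnab⟩
  have hvu : v ≠ u := fun huv => huS (huv ▸ h.1.2.2.2.2.2.2.1)
  obtain ⟨b, c, hbu, hcu, hbc, hnbc, hnbv⟩ : ∃ b c, b ≠ u ∧ c ≠ u ∧ Reaches ends Set.univ b c ∧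
      ¬ Reaches ends {e ∈ Set.univ | u ∉ ends e} b c ∧
      ¬ Reaches ends {e ∈ Set.univ | u ∉ ends e} b v := by
    by_cases hav : Reaches ends {e ∈ Set.univ | u ∉ ends e} a v
    · exact ⟨b, a, hbu, hau, hab.symm, fun hba => hnab hba.symm,
        fun hbv => hnab (hav.trans hbv.symm)⟩
    · exact ⟨a, b, hau, hbu, hab, hnab, hav⟩
  set B : Set V := {x | x ≠ u ∧ Reaches ends {e ∈ Set.univ | u ∉ ends e} b x} with hBdef
  have hclosed : ∀ e x y, ends e = s(x, y) → x ∈ B → y = u ∨ y ∈ B := by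
    intro e x y he hx
    by_cases hyu : y = u
    · exact Or.inl hyu
    · refine Or.inr ⟨hyu, hx.2.trans (Reaches.of_edge ⟨trivial, ?_⟩ he)⟩
      rw [he, Sym2.mem_iff, not_or]
      exact ⟨hx.1.symm, Ne.symm hyu⟩
  have hexit : c ∈ B ∨ ∃ e, ∃ w ∈ B, ends e = s(u, w) := by
    clear hcu hnbc
    induction hbc with
    | refl => exact Or.inl ⟨hbu, Relation.ReflTransGen.refl⟩
    | @tail x y _ hxy ih =>
      obtain hx | hx := ih
      · obtain ⟨e, -, he⟩ := hxy
        obtain rfl | hy := hclosed e x y he hx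
        · exact Or.inr ⟨e, x, hx, he.trans Sym2.eq_swap⟩
        · exact Or.inl hy
      · exact Or.inr hx
  obtain hc | ⟨e, w, hw, he⟩ := hexit
  · exact hnbc hc.2
  · refine h.not_separated huS huR (fun hv => hnbv hv.2) (fun hu => hu.1 rfl) hw he ?_
    intro e x hx hxB y hy
    obtain ⟨x', hx'⟩ := Sym2.mem_iff_exists.1 hx
    rw [hx', Sym2.mem_iff] at hy
    obtain rfl | rfl := hy
    · exact Or.inr hxB
    · exact hclosed e x y hx' hxB

end SteinerPacking
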